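/- The two-parameter Yule-Simon variable X_{θ,ρ} is stochastically decreasing in both parameters: if θ' ≥ θ and ρ' ≥ ρ > 0 then P(X_{θ',ρ'} > n) ≤ P(X_{θ,ρ} > n) for all n ≥ 1. -/

import Mathlib

open MeasureTheory ProbabilityTheory

/-- A realization of the two-parameter Yule–Simon model: a counting process `Y`
started from one individual whose jump intensity is the fertility `F`, where
`F(t) = Y(t) − θ∫₀^t F(s)ds` (i.e. each individual of age `a` gives birth at rate
`e^{-θa}`, so `Y` is the general branching process `Y_θ`), together with an
independent exponential time `T` of rate `ρ`. The Yule–Simon variable is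
`X_{θ,ρ} = Y(T)`. -/
structure YuleSimonSetup (θ ρ : ℝ) where
  Ω : Type
  mΩ : MeasurableSpace Ω
  P : Measure Ω
  isProb : IsProbabilityMeasure P
  ℱ : Filtration ℝ mΩ
  Y : ℝ → Ω → ℕ
  F : ℝ → Ω → ℝ
  T : Ω → ℝ
  /-- joint measurability of the process -/
  measY : Measurable fun p : ℝ × Ω => Y p.1 p.2
  measF : Measurable fun p : ℝ × Ω => F p.1 p.2
  /-- the population starts from a single ancestor -/
  Y0 : ∀ ω, Y 0 ω = 1
  /-- paths are non-decreasing on `[0,∞)` -/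
  mono : ∀ ω, MonotoneOn (fun t => Y t ω) (Set.Ici 0)
  /-- paths are right-continuous (piecewise constant) -/
  rightCont : ∀ ω, ∀ t ≥ (0:ℝ), ∃ ε > 0, ∀ s ∈ Set.Ico t (t + ε), Y s ω = Y t ω
  /-- all jumps have unit size: the process passes through every intermediate value -/
  unitJumps : ∀ ω, ∀ t ≥ (0:ℝ), ∀ k : ℕ, 1 ≤ k → k ≤ Y t ω → ∃ s ∈ Set.Icc 0 t, Y s ω = k
  /-- the fertility solves `F(t) = Y(t) − θ∫₀^t F(s)ds` -/
  F_def : ∀ ω, ∀ t ≥ (0:ℝ), F t ω = (Y t ω : ℝ) - θ * ∫ s in (0:ℝ)..t, F s ω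
  adapted : Adapted ℱ fun t ω => (Y t ω : ℝ)
  integrableY : ∀ t, Integrable (fun ω => (Y t ω : ℝ)) P
  integrableF : ∀ t, Integrable (fun ω => ∫ s in (0:ℝ)..t, F s ω) P
  /-- `Y(t) − ∫₀^t F(s)ds` is a martingale: `F` is the intensity of the counting
  process `Y`, which characterizes `Y` as the general branching process `Y_θ`. -/
  martingale : ∀ s t : ℝ, 0 ≤ s → s ≤ t →
    (P[fun ω => (Y t ω : ℝ) - ∫ u in (0:ℝ)..t, F u ω | ℱ s])
      =ᵐ[P] fun ω => (Y s ω : ℝ) - ∫ u in (0:ℝ)..s, F u ω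
  measT : Measurable T
  /-- `T` is exponentially distributed with parameter `ρ` -/
  lawT : ∀ t : ℝ, 0 ≤ t → P {ω | T ω ≤ t} = ENNReal.ofReal (1 - Real.exp (-ρ * t))
  /-- `T` is independent of the branching process -/
  indepT : IndepFun T (fun ω => fun t : ℝ => Y t ω) P

namespace YuleSimonSetup

attribute [instance] YuleSimonSetup.mΩ YuleSimonSetup.isProb

/-- The tail probability `P(X_{θ,ρ} > n)` of the two-parameter Yule–Simon law. -/
noncomputable def tail {θ ρ : ℝ} (S : YuleSimonSetup θ ρ) (n : ℕ) : ENNReal :=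
  S.P {ω | n < S.Y (S.T ω) ω}

end YuleSimonSetup

noncomputable section

theorem ysFTC (F f' : ℝ → ℝ) (a b : ℝ) (hc : Continuous f') (hd : ∀ x, HasDerivAt F (f' x) x) :
    ∫ x in a..b, f' x = F b - F a :=
  intervalIntegral.integral_eq_sub_of_hasDerivAt (fun x _ => hd x) (hc.intervalIntegrable _ _)

def ysA (θ s : ℝ) : ℝ := ∫ u in (0:ℝ)..s, Real.exp (-θ * u)

def ysh (θ : ℝ) : ℕ → ℝ → ℝ → ℝ
  | 0 => fun _ _ => 1
  | m + 1 => fun t f => ∫ s in (0:ℝ)..t,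
      f * Real.exp (-θ * s) * Real.exp (-(f * ysA θ s)) * ysh θ m (t - s) (f * Real.exp (-θ * s) + 1)

theorem ysA_hasDerivAt (θ s : ℝ) : HasDerivAt (ysA θ) (Real.exp (-θ * s)) s := by
  unfold ysA
  have hc : Continuous fun u : ℝ => Real.exp (-θ * u) := by fun_prop
  exact intervalIntegral.integral_hasDerivAt_right (hc.intervalIntegrable _ _)
    (hc.stronglyMeasurableAtFilter _ _) hc.continuousAt

theorem ysA_continuous (θ : ℝ) : Continuous (ysA θ) :=
  continuous_iff_continuousAt.2 fun s => (ysA_hasDerivAt θ s).continuousAt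

theorem ysA_zero (θ : ℝ) : ysA θ 0 = 0 := by simp [ysA]

theorem ysA_strictMono (θ : ℝ) : StrictMono (ysA θ) :=
  strictMono_of_deriv_pos fun s => by rw [(ysA_hasDerivAt θ s).deriv]; positivity

theorem ysA_nonneg (θ : ℝ) {s : ℝ} (hs : 0 ≤ s) : 0 ≤ ysA θ s := by
  rw [← ysA_zero θ]; exact (ysA_strictMono θ).monotone hs

theorem ysA_exp (θ s : ℝ) : θ * ysA θ s = 1 - Real.exp (-θ * s) := by
  have : (∫ u in (0:ℝ)..s, θ * Real.exp (-θ * u)) =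
      (fun u => - Real.exp (-θ * u)) s - (fun u => - Real.exp (-θ * u)) 0 := by
    refine ysFTC (fun u => - Real.exp (-θ * u)) _ _ _ (by fun_prop) fun x => ?_
    have := (((hasDerivAt_id x).const_mul (-θ)).exp).neg
    refine this.congr_deriv ?_
    simp only [id]; ring
  rw [ysA, ← intervalIntegral.integral_const_mul, this]
  simp; ring

theorem ysA_add (θ v w : ℝ) : ysA θ (v + w) = ysA θ v + Real.exp (-θ * v) * ysA θ w := by
  have hc : Continuous fun u : ℝ => Real.exp (-θ * u) := by fun_prop
  have h1 : ysA θ (v + w) = ysA θ v + ∫ u in v..(v+w), Real.exp (-θ * u) := by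
    unfold ysA
    rw [intervalIntegral.integral_add_adjacent_intervals] <;> exact hc.intervalIntegrable _ _
  have h2 := intervalIntegral.integral_comp_add_left (a := 0) (b := w) (fun u : ℝ => Real.exp (-θ * u)) v
  rw [h1, ysA.eq_1 θ w, ← intervalIntegral.integral_const_mul]
  simp only [add_zero] at h2
  rw [← h2]
  congr 1
  refine intervalIntegral.integral_congr fun u _ => ?_
  rw [← Real.exp_add]; congr 1; ring

theorem ysA_anti {θ θ' : ℝ} (h : θ ≤ θ') {s : ℝ} (hs : 0 ≤ s) : ysA θ' s ≤ ysA θ s := by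
  unfold ysA
  refine intervalIntegral.integral_mono_on hs (Continuous.intervalIntegrable (by fun_prop) _ _)
    (Continuous.intervalIntegrable (by fun_prop) _ _) fun x hx => ?_
  apply Real.exp_le_exp.2
  have := hx.1
  nlinarith

theorem ysh_continuous (θ : ℝ) (m : ℕ) : Continuous fun p : ℝ × ℝ => ysh θ m p.1 p.2 := by
  induction m with
  | zero => simp only [ysh]; exact continuous_const
  | succ m ih =>
    simp only [ysh]
    have hA := ysA_continuous θ
    refine intervalIntegral.continuous_parametric_intervalIntegral_of_continuous
      (f := fun (p : ℝ × ℝ) s => p.2 * Real.exp (-θ * s) * Real.exp (-(p.2 * ysA θ s)) *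
        ysh θ m (p.1 - s) (p.2 * Real.exp (-θ * s) + 1)) (s := fun p => p.1) ?_ continuous_fst
    have : Continuous fun q : (ℝ × ℝ) × ℝ =>
        ysh θ m (q.1.1 - q.2) (q.1.2 * Real.exp (-θ * q.2) + 1) :=
      ih.comp (f := fun q : (ℝ × ℝ) × ℝ => (q.1.1 - q.2, q.1.2 * Real.exp (-θ * q.2) + 1))
        (by fun_prop)
    simp only [Function.uncurry_def]
    fun_prop

theorem ysh_succ_zero (θ : ℝ) (m : ℕ) (f : ℝ) : ysh θ (m+1) 0 f = 0 := by simp [ysh]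

theorem ysB_hasDerivAt (θ f s : ℝ) :
    HasDerivAt (fun s => f * ysA θ s) (f * Real.exp (-θ * s)) s :=
  (ysA_hasDerivAt θ s).const_mul f

theorem ys_integrand_cont (θ : ℝ) (m : ℕ) (t f : ℝ) : Continuous fun s : ℝ =>
    f * Real.exp (-θ * s) * Real.exp (-(f * ysA θ s)) * ysh θ m (t - s) (f * Real.exp (-θ * s) + 1) := by
  have hA := ysA_continuous θ
  have : Continuous fun s : ℝ => ysh θ m (t - s) (f * Real.exp (-θ * s) + 1) :=
    (ysh_continuous θ m).comp (f := fun s : ℝ => (t - s, f * Real.exp (-θ * s) + 1)) (by fun_prop)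
  fun_prop

theorem ysh_mem (θ : ℝ) (m : ℕ) : ∀ t f : ℝ, 0 ≤ t → 0 ≤ f → 0 ≤ ysh θ m t f ∧ ysh θ m t f ≤ 1 := by
  induction m with
  | zero => intro t f _ _; simp [ysh]
  | succ m ih =>
    intro t f ht hf
    have hb : ∀ s ∈ Set.Icc 0 t, 0 ≤ ysh θ m (t - s) (f * Real.exp (-θ * s) + 1) ∧
        ysh θ m (t - s) (f * Real.exp (-θ * s) + 1) ≤ 1 := fun s hs =>
      ih _ _ (by linarith [hs.2]) (by positivity)
    constructor
    · simp only [ysh]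
      refine intervalIntegral.integral_nonneg ht fun s hs => ?_
      have := (hb s hs).1
      positivity
    · have hA := ysA_continuous θ
      have hI : (∫ s in (0:ℝ)..t, f * Real.exp (-θ * s) * Real.exp (-(f * ysA θ s))) =
          (fun s => - Real.exp (-(f * ysA θ s))) t - (fun s => - Real.exp (-(f * ysA θ s))) 0 := by
        refine ysFTC (fun s => - Real.exp (-(f * ysA θ s))) _ _ _ (by fun_prop) fun x => ?_
        have := ((ysB_hasDerivAt θ f x).neg.exp).neg
        refine this.congr_deriv ?_
        ring_nf; simp only [Pi.neg_apply]; ring_nf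
      have hle : ysh θ (m+1) t f ≤ ∫ s in (0:ℝ)..t, f * Real.exp (-θ * s) * Real.exp (-(f * ysA θ s)) := by
        simp only [ysh]
        refine intervalIntegral.integral_mono_on ht ((ys_integrand_cont θ m t f).intervalIntegrable _ _)
          (Continuous.intervalIntegrable (by fun_prop) _ _) fun s hs => ?_
        exact mul_le_of_le_one_right (by positivity) (hb s hs).2
      rw [hI] at hle
      simp only [ysA_zero, mul_zero, neg_zero, Real.exp_zero] at hle
      have := Real.exp_pos (-(f * ysA θ t))
      linarith

/-- derivative along the flow -/
theorem ysh_flow (θ : ℝ) (m : ℕ) (r f v : ℝ) :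
    HasDerivAt (fun v => ysh θ (m+1) (r - v) (f * Real.exp (-θ * v)))
      (f * Real.exp (-θ * v) * (ysh θ (m+1) (r - v) (f * Real.exp (-θ * v)) -
        ysh θ m (r - v) (f * Real.exp (-θ * v) + 1))) v := by
  set g : ℝ → ℝ := fun s => f * Real.exp (-θ * s) * Real.exp (-(f * ysA θ s)) *
    ysh θ m (r - s) (f * Real.exp (-θ * s) + 1) with hg
  have hgc : Continuous g := ys_integrand_cont θ m r f
  have key : ∀ v, ysh θ (m+1) (r - v) (f * Real.exp (-θ * v)) =
      Real.exp (f * ysA θ v) * ∫ x in v..r, g x := by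
    intro v
    have h2 := intervalIntegral.integral_comp_add_left (a := 0) (b := r - v) g v
    simp only [add_zero, add_sub_cancel] at h2
    rw [← h2, ← intervalIntegral.integral_const_mul]
    simp only [ysh]
    refine intervalIntegral.integral_congr fun w _ => ?_
    simp only [hg]
    have e1 : Real.exp (-θ * (v + w)) = Real.exp (-θ * v) * Real.exp (-θ * w) := by
      rw [← Real.exp_add]; congr 1; ring
    have e2 : Real.exp (-(f * ysA θ (v+w))) =
      Real.exp (-(f * ysA θ v)) * Real.exp (-(f * Real.exp (-θ * v) * ysA θ w)) := by
      rw [ysA_add, ← Real.exp_add]; congr 1; ring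
    have e3 : Real.exp (f * ysA θ v) * Real.exp (-(f * ysA θ v)) = 1 := by
      rw [← Real.exp_add]; simp
    rw [e1, e2, sub_sub, ← mul_assoc f]
    linear_combination (-(f * Real.exp (-θ * v) * Real.exp (-θ * w) *
      Real.exp (-(f * Real.exp (-θ * v) * ysA θ w)) *
      ysh θ m (r - (v+w)) (f * Real.exp (-θ * v) * Real.exp (-θ * w) + 1))) * e3
  have hd : HasDerivAt (fun v => Real.exp (f * ysA θ v) * ∫ x in v..r, g x)
      (Real.exp (f * ysA θ v) * (f * Real.exp (-θ * v)) * (∫ x in v..r, g x) +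
        Real.exp (f * ysA θ v) * (- g v)) v :=
    ((ysB_hasDerivAt θ f v).exp).mul (intervalIntegral.integral_hasDerivAt_left
      (hgc.intervalIntegrable _ _) (hgc.stronglyMeasurableAtFilter _ _) hgc.continuousAt)
  rw [funext key]
  convert hd using 1
  rw [key v]
  have e3 : Real.exp (f * ysA θ v) * Real.exp (-(f * ysA θ v)) = 1 := by
    rw [← Real.exp_add]; simp
  simp only [hg]
  linear_combination (f * Real.exp (-θ * v) * ysh θ m (r - v) (f * Real.exp (-θ * v) + 1)) * e3

theorem ysh_mono {θ θ' : ℝ} (hθ : θ ≤ θ') (m : ℕ) : ∀ t t' f f' : ℝ, 0 ≤ t' → t' ≤ t → 0 < f' → f' ≤ f →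
    ysh θ' m t' f' ≤ ysh θ m t f := by
  induction m with
  | zero => intros; simp [ysh]
  | succ m ih =>
    intro t t' f f' ht' htt hf' hff
    have ht : 0 ≤ t := ht'.trans htt
    have hf : 0 < f := hf'.trans_le hff
    -- change of variables
    have cov : ∀ (θ t f : ℝ), 0 ≤ t → 0 < f → ∃ Ψ : ℝ → ℝ,
        (∀ s ∈ Set.Icc 0 t, Ψ (f * ysA θ s) = ysh θ m (t - s) (f * Real.exp (-θ * s) + 1)) ∧
        IntegrableOn (fun a => Real.exp (-a) * Ψ a) (Set.Icc 0 (f * ysA θ t)) ∧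
        ysh θ (m+1) t f = ∫ a in Set.Icc 0 (f * ysA θ t), Real.exp (-a) * Ψ a := by
      intro θ t f ht hf
      have hsm : StrictMono fun s => f * ysA θ s := (ysA_strictMono θ).const_mul hf
      have himg : (fun s => f * ysA θ s) '' Set.Icc 0 t = Set.Icc 0 (f * ysA θ t) := by
        have hc : Continuous fun s => f * ysA θ s := continuous_const.mul (ysA_continuous θ)
        apply Set.Subset.antisymm
        · rintro _ ⟨s, hs, rfl⟩
          exact ⟨mul_nonneg hf.le (ysA_nonneg θ hs.1), hsm.monotone hs.2⟩
        · have := intermediate_value_Icc ht hc.continuousOn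
          simpa [ysA_zero] using this
      let inv := Function.invFun fun s => f * ysA θ s
      have hinv : ∀ s, inv (f * ysA θ s) = s := Function.leftInverse_invFun hsm.injective
      refine ⟨fun a => ysh θ m (t - inv a) (f * Real.exp (-θ * inv a) + 1), ?_, ?_, ?_⟩
      · intro s _; simp only [hinv]
      · rw [← himg]
        rw [integrableOn_image_iff_integrableOn_abs_deriv_smul measurableSet_Icc
          (fun x _ => (ysB_hasDerivAt θ f x).hasDerivWithinAt) hsm.injective.injOn]
        refine ((ys_integrand_cont θ m t f).integrableOn_Icc).congr_fun (fun s _ => ?_) measurableSet_Icc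
        simp only [hinv, smul_eq_mul]
        rw [abs_of_nonneg (by positivity), mul_assoc]
      · rw [← himg]
        rw [integral_image_eq_integral_abs_deriv_smul measurableSet_Icc
          (fun x _ => (ysB_hasDerivAt θ f x).hasDerivWithinAt) hsm.injective.injOn]
        simp only [ysh]
        rw [intervalIntegral.integral_of_le ht, ← integral_Icc_eq_integral_Ioc]
        refine setIntegral_congr_fun measurableSet_Icc (fun s _ => ?_)
        simp only [hinv, smul_eq_mul]
        rw [abs_of_nonneg (by positivity), mul_assoc]
    obtain ⟨Ψ, h1, h2, h3⟩ := cov θ t f ht hf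
    obtain ⟨Ψ', h1', h2', h3'⟩ := cov θ' t' f' ht' hf'
    have hBB : ∀ s, 0 ≤ s → f' * ysA θ' s ≤ f * ysA θ s := fun s hs =>
      mul_le_mul hff (ysA_anti hθ hs) (ysA_nonneg _ hs) hf.le
    have hivt : ∀ (θ f t : ℝ), 0 ≤ t → Set.Icc 0 (f * ysA θ t) ⊆ (fun s => f * ysA θ s) '' Set.Icc 0 t := by
      intro θ f t ht
      have hc : Continuous fun s => f * ysA θ s := continuous_const.mul (ysA_continuous θ)
      have := intermediate_value_Icc ht hc.continuousOn
      simpa [ysA_zero] using this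
    have hsub : Set.Icc 0 (f' * ysA θ' t') ⊆ Set.Icc 0 (f * ysA θ t) :=
      Set.Icc_subset_Icc_right ((hBB t' ht').trans
        (mul_le_mul_of_nonneg_left ((ysA_strictMono θ).monotone htt) hf.le))
    rw [h3, h3']
    calc _ ≤ ∫ a in Set.Icc 0 (f' * ysA θ' t'), Real.exp (-a) * Ψ a := by
          refine setIntegral_mono_on h2' (h2.mono_set hsub) measurableSet_Icc fun a ha => ?_
          obtain ⟨s', hs', rfl⟩ := hivt θ' f' t' ht' ha
          obtain ⟨s, hs, hss⟩ := hivt θ f s' hs'.1 ⟨ha.1, hBB s' hs'.1⟩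
          simp only at hss ⊢
          apply mul_le_mul_of_nonneg_left _ (Real.exp_pos _).le
          rw [h1' s' hs', ← hss, h1 s ⟨hs.1, hs.2.trans (hs'.2.trans htt)⟩]
          refine ih _ _ _ _ (by linarith [hs'.2]) (by linarith [hs.2]) (by positivity) ?_
          have e1 := ysA_exp θ s
          have e2 := ysA_exp θ' s'
          have e3 : Real.exp (-θ * s) = 1 - θ * ysA θ s := by linarith
          have e4 : Real.exp (-θ' * s') = 1 - θ' * ysA θ' s' := by linarith
          rw [e3, e4]
          have : 0 ≤ f' * ysA θ' s' := ha.1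
          have t1 : f * (1 - θ * ysA θ s) = f - θ * (f' * ysA θ' s') := by rw [← hss]; ring
          have t2 : f' * (1 - θ' * ysA θ' s') = f' - θ' * (f' * ysA θ' s') := by ring
          rw [t1, t2]
          nlinarith
      _ ≤ _ := by
          refine setIntegral_mono_set h2 ?_ (Filter.Eventually.of_forall hsub)
          refine (ae_restrict_iff' measurableSet_Icc).2 (Filter.Eventually.of_forall fun a ha => ?_)
          obtain ⟨s, hs, rfl⟩ := hivt θ f t ht ha
          simp only [Pi.zero_apply]
          rw [h1 s hs]
          exact mul_nonneg (Real.exp_pos _).le (ysh_mem θ m _ _ (by linarith [hs.2]) (by positivity)).1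

/-- one step error without a jump -/
theorem ysh_step (θ : ℝ) (m : ℕ) (r f δ ε : ℝ) (hf : 0 ≤ f) (hδ : 0 ≤ δ)
    (h : ∀ v ∈ Set.Icc 0 δ, |ysh θ (m+1) (r - v) (f * Real.exp (-θ * v)) - ysh θ (m+1) r f| ≤ ε)
    (h' : ∀ v ∈ Set.Icc 0 δ, |ysh θ m (r - v) (f * Real.exp (-θ * v) + 1) - ysh θ m r (f + 1)| ≤ ε) :
    |ysh θ (m+1) (r - δ) (f * Real.exp (-θ * δ)) - ysh θ (m+1) r f
      + (ysh θ m r (f+1) - ysh θ (m+1) r f) * (f * ysA θ δ)| ≤ 2 * ε * (f * ysA θ δ) := by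
  have hA := ysA_continuous θ
  have c1 : Continuous fun v : ℝ => ysh θ (m+1) (r - v) (f * Real.exp (-θ * v)) :=
    (ysh_continuous θ (m+1)).comp (f := fun s : ℝ => (r - s, f * Real.exp (-θ * s))) (by fun_prop)
  have c2 : Continuous fun v : ℝ => ysh θ m (r - v) (f * Real.exp (-θ * v) + 1) :=
    (ysh_continuous θ m).comp (f := fun s : ℝ => (r - s, f * Real.exp (-θ * s) + 1)) (by fun_prop)
  set H0 := ysh θ m r (f+1) - ysh θ (m+1) r f with hH0
  have hI : (∫ v in (0:ℝ)..δ, (f * Real.exp (-θ * v)) * ((ysh θ (m+1) (r - v) (f * Real.exp (-θ * v)) -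
        ysh θ m (r - v) (f * Real.exp (-θ * v) + 1)) + H0)) =
      (fun v => ysh θ (m+1) (r - v) (f * Real.exp (-θ * v)) + H0 * (f * ysA θ v)) δ -
      (fun v => ysh θ (m+1) (r - v) (f * Real.exp (-θ * v)) + H0 * (f * ysA θ v)) 0 := by
    refine ysFTC (fun v => ysh θ (m+1) (r - v) (f * Real.exp (-θ * v)) + H0 * (f * ysA θ v)) _ _ _ (by fun_prop) fun x => ?_
    refine ((ysh_flow θ m r f x).add ((ysB_hasDerivAt θ f x).const_mul H0)).congr_deriv ?_
    ring
  have e : ysh θ (m+1) (r - δ) (f * Real.exp (-θ * δ)) - ysh θ (m+1) r f + H0 * (f * ysA θ δ) =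
      ∫ v in (0:ℝ)..δ, (f * Real.exp (-θ * v)) * ((ysh θ (m+1) (r - v) (f * Real.exp (-θ * v)) -
        ysh θ m (r - v) (f * Real.exp (-θ * v) + 1)) + H0) := by
    rw [hI]; simp [ysA_zero]; ring
  rw [e]
  have e2 : 2 * ε * (f * ysA θ δ) = ∫ v in (0:ℝ)..δ, 2 * ε * (f * Real.exp (-θ * v)) := by
    rw [intervalIntegral.integral_const_mul, intervalIntegral.integral_const_mul]; rfl
  rw [e2]
  refine (intervalIntegral.abs_integral_le_integral_abs hδ).trans ?_
  refine intervalIntegral.integral_mono_on hδ (Continuous.intervalIntegrable (by fun_prop) _ _)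
    (Continuous.intervalIntegrable (by fun_prop) _ _) fun v hv => ?_
  rw [abs_mul, abs_of_nonneg (by positivity : 0 ≤ f * Real.exp (-θ * v)), mul_comm]
  apply mul_le_mul_of_nonneg_right _ (by positivity)
  have a1 := abs_le.1 (h v hv)
  have a2 := abs_le.1 (h' v hv)
  rw [abs_le]; constructor <;> rw [hH0] <;> linarith [a1.1, a1.2, a2.1, a2.2]

end
noncomputable section
open Filter Topology

structure YPath (θ : ℝ) (y : ℝ → ℕ) (F : ℝ → ℝ) : Prop where
  y0 : y 0 = 1
  mono : MonotoneOn y (Set.Ici 0)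
  rc : ∀ t ≥ (0:ℝ), ∃ ε > 0, ∀ s ∈ Set.Ico t (t + ε), y s = y t
  uj : ∀ t ≥ (0:ℝ), ∀ k : ℕ, 1 ≤ k → k ≤ y t → ∃ s ∈ Set.Icc 0 t, y s = k
  F_def : ∀ t ≥ (0:ℝ), F t = (y t : ℝ) - θ * ∫ s in (0:ℝ)..t, F s
  meas : Measurable F

namespace YPath
variable {θ : ℝ} {y : ℝ → ℕ} {F : ℝ → ℝ}

theorem monoR (h : YPath θ y F) : MonotoneOn (fun t => (y t : ℝ)) (Set.Ici 0) :=
  fun _ ha _ hb hab => Nat.cast_le.2 (h.mono ha hb hab)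

theorem one_le (h : YPath θ y F) {t : ℝ} (ht : 0 ≤ t) : 1 ≤ y t := by
  rw [← h.y0]; exact h.mono Set.self_mem_Ici ht ht

theorem int_y (h : YPath θ y F) {a b : ℝ} (ha : 0 ≤ a) (hb : 0 ≤ b) :
    IntervalIntegrable (fun u => Real.exp (θ * u) * (y u : ℝ)) volume a b := by
  refine IntervalIntegrable.continuousOn_mul ?_ (by fun_prop)
  refine (h.monoR.mono fun x hx => ?_).intervalIntegrable
  exact le_trans (le_min ha hb) hx.1

theorem cont_W (h : YPath θ y F) {t : ℝ} (ht : 0 ≤ t) :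
    ContinuousOn (fun r => ∫ u in (0:ℝ)..r, Real.exp (θ * u) * (y u : ℝ)) (Set.Icc 0 t) := by
  have := intervalIntegral.continuousOn_primitive_interval' (h.int_y le_rfl ht) (a := 0)
    Set.left_mem_uIcc
  rwa [Set.uIcc_of_le ht] at this

theorem I_eq' (h : YPath θ y F) {r : ℝ} (hr : 0 ≤ r) (hi : IntervalIntegrable F volume 0 r) :
    Real.exp (θ * r) * (∫ u in (0:ℝ)..r, F u) = ∫ u in (0:ℝ)..r, Real.exp (θ * u) * (y u : ℝ) := by
  have hcI : ContinuousOn (fun b => ∫ u in (0:ℝ)..b, F u) (Set.uIcc 0 r) :=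
    intervalIntegral.continuousOn_primitive_interval' hi Set.left_mem_uIcc
  have hE : ∀ x, HasDerivAt (fun x => Real.exp (θ * x)) (Real.exp (θ * x) * θ) x := fun x => by
    have := ((hasDerivAt_id x).const_mul θ).exp
    simpa using this
  have key := intervalIntegral.integral_eq_sub_of_hasDeriv_right (a := 0) (b := r)
    (f := fun x => Real.exp (θ * x) * (∫ u in (0:ℝ)..x, F u))
    (f' := fun u => Real.exp (θ * u) * (y u : ℝ))
    (ContinuousOn.mul (by fun_prop) hcI) (fun x hx => ?_) (h.int_y le_rfl hr)
  · rw [key]; simp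
  · rw [min_eq_left hr, max_eq_right hr] at hx
    have hx0 : 0 ≤ x := hx.1.le
    have hcx : ContinuousAt (fun b => ∫ u in (0:ℝ)..b, F u) x := by
      refine hcI.continuousAt ?_
      rw [Set.uIcc_of_le hr]
      exact Icc_mem_nhds hx.1 hx.2
    have hFc : ContinuousWithinAt F (Set.Ioi x) x := by
      obtain ⟨ε, hε, hy⟩ := h.rc x hx0
      have h1 : ContinuousWithinAt (fun v => (y x : ℝ) - θ * ∫ u in (0:ℝ)..v, F u) (Set.Ioi x) x :=
        (continuousAt_const.sub (continuousAt_const.mul hcx)).continuousWithinAt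
      refine h1.congr_of_eventuallyEq ?_ (h.F_def x hx0)
      have : Set.Ioo x (x + ε) ∈ 𝓝[>] x := Ioo_mem_nhdsGT (by linarith)
      filter_upwards [this] with v hv
      rw [h.F_def v (by linarith [hv.1]), hy v ⟨hv.1.le, hv.2⟩]
    have hd : HasDerivWithinAt (fun b => ∫ u in (0:ℝ)..b, F u) (F x) (Set.Ici x) x := by
      refine intervalIntegral.integral_hasDerivWithinAt_right (t := Set.Ioi x) ?_
        (h.meas.aestronglyMeasurable.stronglyMeasurableAtFilter) hFc
      exact hi.mono_set (by rw [Set.uIcc_of_le hx0, Set.uIcc_of_le hr]; exact Set.Icc_subset_Icc_right hx.2.le)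
    have := (hE x).hasDerivWithinAt.mul (hd.mono Set.Ioi_subset_Ici_self)
    refine this.congr_deriv ?_
    rw [h.F_def x hx0]; ring

theorem exists_bound (h : YPath θ y F) {t : ℝ} (ht : 0 ≤ t) :
    ∃ C, ∀ r ∈ Set.Icc 0 t, |F r| ≤ C := by
  have hc : ContinuousOn (fun r => Real.exp (-θ * r) * ∫ u in (0:ℝ)..r, Real.exp (θ * u) * (y u : ℝ))
    (Set.Icc 0 t) := ContinuousOn.mul (by fun_prop) (h.cont_W ht)
  obtain ⟨C1, hC1⟩ := isCompact_Icc.exists_bound_of_continuousOn hc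
  have hC0 : 0 ≤ C1 := (norm_nonneg _).trans (hC1 0 ⟨le_rfl, ht⟩)
  refine ⟨y t + |θ| * C1, fun r hr => ?_⟩
  have hI : |∫ u in (0:ℝ)..r, F u| ≤ C1 := by
    by_cases hi : IntervalIntegrable F volume 0 r
    · have e := h.I_eq' hr.1 hi
      have : (∫ u in (0:ℝ)..r, F u) = Real.exp (-θ * r) * ∫ u in (0:ℝ)..r, Real.exp (θ * u) * (y u : ℝ) := by
        rw [← e, ← mul_assoc, ← Real.exp_add]; simp
      rw [this]; exact hC1 r hr
    · rw [intervalIntegral.integral_undef hi]; simpa using hC0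
  rw [h.F_def r hr.1]
  refine (abs_sub _ _).trans ?_
  rw [abs_mul, Nat.abs_cast]
  have : (y r : ℝ) ≤ y t := h.monoR hr.1 ht hr.2
  gcongr

theorem int_F0 (h : YPath θ y F) {t : ℝ} (ht : 0 ≤ t) : IntervalIntegrable F volume 0 t := by
  obtain ⟨C, hC⟩ := h.exists_bound ht
  rw [intervalIntegrable_iff_integrableOn_Icc_of_le ht]
  refine Measure.integrableOn_of_bounded (M := C) (by simp) h.meas.aestronglyMeasurable ?_
  exact (ae_restrict_iff' measurableSet_Icc).2 (Eventually.of_forall hC)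

theorem int_F (h : YPath θ y F) {a b : ℝ} (ha : 0 ≤ a) (hb : 0 ≤ b) : IntervalIntegrable F volume a b :=
  (h.int_F0 ha).symm.trans (h.int_F0 hb)

theorem F_eq (h : YPath θ y F) {r : ℝ} (hr : 0 ≤ r) :
    Real.exp (θ * r) * F r = Real.exp (θ * r) * (y r : ℝ) - θ * ∫ u in (0:ℝ)..r, Real.exp (θ * u) * (y u : ℝ) := by
  rw [← h.I_eq' hr (h.int_F0 hr), h.F_def r hr]; ring

theorem pos (h : YPath θ y F) {r : ℝ} (hr : 0 ≤ r) : 0 < F r := by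
  have h1 : (1:ℝ) ≤ y r := by exact_mod_cast h.one_le hr
  have hpos : 0 < Real.exp (θ * r) := Real.exp_pos _
  suffices 0 < Real.exp (θ * r) * F r from (pos_iff_pos_of_mul_pos this).1 hpos
  rw [h.F_eq hr]
  have hW0 : 0 ≤ ∫ u in (0:ℝ)..r, Real.exp (θ * u) * (y u : ℝ) :=
    intervalIntegral.integral_nonneg hr fun u _ => by positivity
  rcases le_total 0 θ with hθ | hθ
  · have hW : (∫ u in (0:ℝ)..r, Real.exp (θ * u) * (y u : ℝ)) ≤ ysA (-θ) r * y r := by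
      rw [ysA, ← intervalIntegral.integral_mul_const]
      refine intervalIntegral.integral_mono_on hr (h.int_y le_rfl hr)
        ((by fun_prop : Continuous fun u : ℝ => Real.exp (- -θ * u) * (y r : ℝ)).intervalIntegrable _ _) fun u hu => ?_
      rw [neg_neg]
      have : (y u : ℝ) ≤ y r := h.monoR hu.1 hr hu.2
      gcongr
    have e := ysA_exp (-θ) r
    rw [neg_neg] at e
    have := mul_le_mul_of_nonneg_left hW hθ
    have e2 : θ * (ysA (-θ) r * y r) = (Real.exp (θ * r) - 1) * y r := by
      rw [← mul_assoc]; congr 1; linarith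
    rw [e2] at this
    nlinarith
  · have : θ * (∫ u in (0:ℝ)..r, Real.exp (θ * u) * (y u : ℝ)) ≤ 0 := mul_nonpos_of_nonpos_of_nonneg hθ hW0
    have : 0 < Real.exp (θ * r) * (y r : ℝ) := by positivity
    linarith

theorem flow (h : YPath θ y F) {s v : ℝ} (hs : 0 ≤ s) (hv : 0 ≤ v) (hy : y (s + v) = y s) :
    F (s + v) = F s * Real.exp (-θ * v) := by
  have hc : ∀ u ∈ Set.Icc s (s+v), y u = y s := fun u hu => by
    have a := h.mono hs (hs.trans hu.1 : (0:ℝ) ≤ u) hu.1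
    have b := h.mono (hs.trans hu.1 : (0:ℝ) ≤ u) (by linarith : (0:ℝ) ≤ s + v) hu.2
    omega
  have hW : (∫ u in (0:ℝ)..(s+v), Real.exp (θ * u) * (y u : ℝ)) =
      (∫ u in (0:ℝ)..s, Real.exp (θ * u) * (y u : ℝ)) + (ysA (-θ) (s+v) - ysA (-θ) s) * y s := by
    rw [← intervalIntegral.integral_add_adjacent_intervals (h.int_y le_rfl hs) (h.int_y hs (by linarith : (0:ℝ) ≤ s+v))]
    congr 1
    have : (∫ u in s..(s+v), Real.exp (θ * u) * (y u : ℝ)) = ∫ u in s..(s+v), Real.exp (- -θ * u) * (y s : ℝ) := by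
      refine intervalIntegral.integral_congr fun u hu => ?_
      rw [Set.uIcc_of_le (by linarith)] at hu
      simp only [neg_neg]
      rw [hc u hu]
    rw [this, intervalIntegral.integral_mul_const]
    congr 1
    exact ysFTC (ysA (-θ)) _ _ _ (by fun_prop) (ysA_hasDerivAt (-θ))
  have e1 := h.F_eq (by linarith : (0:ℝ) ≤ s + v)
  have e2 := h.F_eq hs
  rw [hW, hy] at e1
  have a1 := ysA_exp (-θ) (s+v)
  have a2 := ysA_exp (-θ) s
  rw [neg_neg] at a1 a2
  have e3 : Real.exp (θ * (s+v)) * F (s+v) = Real.exp (θ * s) * F s := by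
    linear_combination e1 - e2 + (y s : ℝ) * (a1 - a2)
  have e4 : Real.exp (θ * (s+v)) * Real.exp (-θ * v) = Real.exp (θ * s) := by
    rw [← Real.exp_add]; congr 1; ring
  refine mul_left_cancel₀ (Real.exp_pos (θ * (s+v))).ne' ?_
  rw [e3, ← e4]; ring

theorem F_diff (h : YPath θ y F) {s s' : ℝ} (hs : 0 ≤ s) (hs' : 0 ≤ s') :
    F s' - F s = (y s' : ℝ) - y s - θ * ∫ u in s..s', F u := by
  rw [h.F_def s hs, h.F_def s' hs', ← intervalIntegral.integral_add_adjacent_intervals (h.int_F0 hs) (h.int_F hs hs')]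
  ring

theorem int_flow (h : YPath θ y F) {s v : ℝ} (hs : 0 ≤ s) (hv : 0 ≤ v) (hy : y (s + v) = y s) :
    ∫ u in s..(s+v), F u = F s * ysA θ v := by
  have h2 := intervalIntegral.integral_comp_add_left (a := 0) (b := v) F s
  simp only [add_zero] at h2
  rw [← h2, ysA, ← intervalIntegral.integral_const_mul]
  refine intervalIntegral.integral_congr fun u hu => ?_
  rw [Set.uIcc_of_le hv] at hu
  refine h.flow hs hu.1 ?_
  have a := h.mono hs (by linarith [hu.1] : (0:ℝ) ≤ s + u) (by linarith [hu.1])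
  have b := h.mono (by linarith [hu.1] : (0:ℝ) ≤ s + u) (by linarith : (0:ℝ) ≤ s + v) (by linarith [hu.2])
  omega

theorem gap (h : YPath θ y F) {t : ℝ} (ht : 0 ≤ t) :
    ∃ δ > 0, ∀ s s', 0 ≤ s → s ≤ s' → s' ≤ t → s' - s < δ → y s' ≤ y s + 1 := by
  have hk : ∀ k ∈ Finset.Icc 1 (y t), ∀ᶠ δ in 𝓝[>] (0:ℝ), ∀ s s', 0 ≤ s → s ≤ s' → s' ≤ t → s' - s < δ →
      y s < k → y s' ≤ k := by
    intro k hk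
    rw [Finset.mem_Icc] at hk
    obtain ⟨ρ, hρ, hρk⟩ := h.uj t ht k hk.1 hk.2
    obtain ⟨ε, hε, hc⟩ := h.rc ρ hρ.1
    filter_upwards [Ioo_mem_nhdsGT hε] with δ hδ s s' hs hss hst hd hsk
    by_contra! hcon
    have h1 : s < ρ := by
      by_contra! hh
      have := h.mono hρ.1 hs hh
      omega
    have h2 : ρ < s' := by
      by_contra! hh
      have := h.mono (hs.trans hss : (0:ℝ) ≤ s') hρ.1 hh
      omega
    have := hc s' ⟨h2.le, by linarith [hδ.2]⟩
    omega
  have := (Filter.eventually_all_finset (Finset.Icc 1 (y t))).2 hk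
  obtain ⟨δ, hδ, hpos⟩ := (this.and self_mem_nhdsWithin).exists
  refine ⟨δ, hpos, fun s s' hs hss hst hd => ?_⟩
  by_contra! hcon
  have h3 := h.mono (hs.trans hss : (0:ℝ) ≤ s') ht hst
  have := hδ (y s + 1) (Finset.mem_Icc.2 ⟨by omega, by omega⟩) s s' hs hss hst hd (by omega)
  omega

def G (θ : ℝ) (y : ℝ → ℕ) (F : ℝ → ℝ) (n : ℕ) (t s : ℝ) : ℝ := ysh θ (n + 1 - y s) (t - s) (F s)
def H (θ : ℝ) (y : ℝ → ℕ) (F : ℝ → ℝ) (n : ℕ) (t s : ℝ) : ℝ :=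
  ysh θ (n - y s) (t - s) (F s + 1) - ysh θ (n + 1 - y s) (t - s) (F s)
def M (y : ℝ → ℕ) (F : ℝ → ℝ) (s : ℝ) : ℝ := (y s : ℝ) - ∫ u in (0:ℝ)..s, F u

theorem step (h : YPath θ y F) (n : ℕ) {t : ℝ} (ht : 0 ≤ t) {ε : ℝ} (hε : 0 < ε) :
    ∃ δ > 0, ∀ s s', 0 ≤ s → s ≤ s' → s' ≤ t → s' - s < δ →
      |G θ y F n t s' - G θ y F n t s - H θ y F n t s * (M y F s' - M y F s)| ≤
        2 * ε * (((y s' : ℝ) - y s) + ∫ u in s..s', F u) := by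
  obtain ⟨K, hK⟩ := h.exists_bound ht
  have hK0 : 0 ≤ K := (abs_nonneg _).trans (hK 0 ⟨le_rfl, ht⟩)
  have huc : ∀ m ∈ Finset.range (n+2), ∀ᶠ η in 𝓝[>] (0:ℝ), ∀ p q : ℝ × ℝ, p ∈ Set.Icc 0 t ×ˢ Set.Icc 0 (K+1) →
      q ∈ Set.Icc 0 t ×ˢ Set.Icc 0 (K+1) → dist p q < η → |ysh θ m p.1 p.2 - ysh θ m q.1 q.2| ≤ ε := by
    intro m _
    have huc := (isCompact_Icc.prod isCompact_Icc : IsCompact (Set.Icc 0 t ×ˢ Set.Icc 0 (K+1))).uniformContinuousOn_of_continuous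
      (ysh_continuous θ m).continuousOn
    obtain ⟨η0, hη0, hu⟩ := Metric.uniformContinuousOn_iff.1 huc ε hε
    filter_upwards [Ioo_mem_nhdsGT hη0] with η hη p q hp hq hd
    exact (hu p hp q hq (hd.trans hη.2)).le
  obtain ⟨η, hη, hη0⟩ := (((Filter.eventually_all_finset _).2 huc).and self_mem_nhdsWithin).exists
  obtain ⟨δ1, hδ1, hgap⟩ := h.gap ht
  have hη0 : 0 < η := hη0
  refine ⟨min δ1 (min (η / (|θ| * K + 1)) (ε / (K + 1))), by positivity, ?_⟩
  intro s s' hs hss hst hd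
  have hs' : 0 ≤ s' := hs.trans hss
  have hd1 : s' - s < δ1 := hd.trans_le (min_le_left _ _)
  have hd2 : (s' - s) * (|θ| * K + 1) < η := by
    have := hd.trans_le ((min_le_right _ _).trans (min_le_left _ _))
    rwa [lt_div_iff₀ (by positivity)] at this
  have hd3 : (s' - s) * (K + 1) < ε := by
    have := hd.trans_le ((min_le_right _ _).trans (min_le_right _ _))
    rwa [lt_div_iff₀ (by positivity)] at this
  have hA0 : ∀ u, s ≤ u → u ≤ s' → 0 ≤ ∫ x in s..u, F x := fun u h1 _ =>
    intervalIntegral.integral_nonneg h1 fun x hx => (h.pos (hs.trans hx.1)).le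
  have hA1 : ∀ u, s ≤ u → u ≤ s' → ∫ x in s..u, F x ≤ (s' - s) * K := by
    intro u h1 h2
    have : ∫ x in s..u, F x ≤ ∫ x in s..u, K :=
      intervalIntegral.integral_mono_on h1 (h.int_F hs (hs.trans h1)) (by simp) fun x hx =>
        (le_abs_self _).trans (hK x ⟨hs.trans hx.1, hx.2.trans (h2.trans hst)⟩)
    rw [intervalIntegral.integral_const, smul_eq_mul] at this
    refine this.trans ?_
    gcongr
  have hθA : ∀ u, s ≤ u → u ≤ s' → |θ * ∫ x in s..u, F x| < η := by
    intro u h1 h2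
    rw [abs_mul, abs_of_nonneg (hA0 u h1 h2)]
    have := mul_le_mul_of_nonneg_left (hA1 u h1 h2) (abs_nonneg θ)
    nlinarith
  have hsη : s' - s < η := by nlinarith [abs_nonneg θ, mul_nonneg (abs_nonneg θ) hK0, mul_nonneg (mul_nonneg (abs_nonneg θ) hK0) (sub_nonneg.2 hss)]
  have hFK : ∀ u, 0 ≤ u → u ≤ t → F u ≤ K := fun u h1 h2 => (le_abs_self _).trans (hK u ⟨h1, h2⟩)
  have hM : M y F s' - M y F s = ((y s' : ℝ) - y s) - ∫ u in s..s', F u := by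
    unfold M
    rw [← intervalIntegral.integral_add_adjacent_intervals (h.int_F0 hs) (h.int_F hs hs')]; ring
  rw [hM]
  have hmono : y s ≤ y s' := h.mono hs hs' hss
  have hnn : 0 ≤ 2 * ε * (((y s' : ℝ) - y s) + ∫ u in s..s', F u) := by
    have : (y s : ℝ) ≤ y s' := by exact_mod_cast hmono
    have := hA0 s' hss le_rfl
    have : 0 ≤ ((y s' : ℝ) - y s) + ∫ u in s..s', F u := by linarith
    positivity
  by_cases hn : n + 1 ≤ y s
  · have e1 : n + 1 - y s = 0 := by omega
    have e2 : n - y s = 0 := by omega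
    have e3 : n + 1 - y s' = 0 := by omega
    simp only [G, H, e1, e2, e3, ysh]
    simpa using hnn
  · have e1 : n + 1 - y s = (n - y s) + 1 := by omega
    set m := n - y s with hm
    have hmr : m + 1 ∈ Finset.range (n+2) := by rw [Finset.mem_range]; omega
    have hmr' : m ∈ Finset.range (n+2) := by rw [Finset.mem_range]; omega
    have hFs := hFK s hs (hss.trans hst)
    have hFs0 := (h.pos hs).le
    rcases Nat.lt_or_ge (y s) (y s') with hlt | hge
    · -- one jump
      have hy : y s' = y s + 1 := le_antisymm (hgap s s' hs hss hst hd1) hlt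
      have e3 : n + 1 - y s' = m := by omega
      simp only [G, H, e1, e3, ← hm]
      have hFd := h.F_diff hs hs'
      rw [hy] at hFd
      push_cast at hFd
      have hcl := hη m hmr' (t - s', F s') (t - s, F s + 1) ⟨⟨by simp; linarith, by simp; linarith⟩, (h.pos hs').le, by
          have := hFK s' hs' hst; simp only; linarith⟩ ⟨⟨by simp; linarith, by simp; linarith⟩, by simp only; linarith, by simp only; linarith⟩ (by
          rw [Prod.dist_eq, max_lt_iff, Real.dist_eq, Real.dist_eq]
          constructor
          · rw [abs_lt]; constructor <;> simp only <;> linarith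
          · have := hθA s' hss le_rfl
            have e : F s' - (F s + 1) = -(θ * ∫ u in s..s', F u) := by linarith
            simp only
            rw [e, abs_neg]; exact this)
      simp only at hcl
      have b1 := ysh_mem θ m (t - s) (F s + 1) (by linarith) (by linarith)
      have b2 := ysh_mem θ (m+1) (t - s) (F s) (by linarith) hFs0
      have a0 := hA0 s' hss le_rfl
      have a1 : ∫ x in s..s', F x ≤ ε := by have := hA1 s' hss le_rfl; nlinarith
      set A := ∫ x in s..s', F x
      set p := ysh θ m (t - s) (F s + 1)
      set q := ysh θ (m+1) (t - s) (F s)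
      set z := ysh θ m (t - s') (F s')
      have hpq : |(p - q) * A| ≤ ε := by
        rw [abs_mul, abs_of_nonneg a0]
        have : |p - q| ≤ 1 := by rw [abs_le]; constructor <;> linarith [b1.1, b1.2, b2.1, b2.2]
        nlinarith
      rw [hy]; push_cast
      have e : z - q - (p - q) * (↑(y s) + 1 - ↑(y s) - A) = (z - p) + (p - q) * A := by ring
      rw [e]
      refine (abs_add_le _ _).trans ?_
      nlinarith
    · have hy : y s' = y s := le_antisymm hge hmono
      obtain ⟨v, rfl⟩ : ∃ v, s' = s + v := ⟨s' - s, by ring⟩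
      have hv : 0 ≤ v := by linarith
      have hcst : ∀ u ∈ Set.Icc 0 v, y (s + u) = y s := fun u hu => by
        have a := h.mono hs (by linarith [hu.1] : (0:ℝ) ≤ s + u) (by linarith [hu.1])
        have b := h.mono (by linarith [hu.1] : (0:ℝ) ≤ s + u) hs' (by linarith [hu.2])
        omega
      have hcl : ∀ u ∈ Set.Icc 0 v, |F s * Real.exp (-θ * u) - F s| < η := fun u hu => by
        rw [← h.flow hs hu.1 (hcst u hu), h.F_diff hs (by linarith [hu.1]), hcst u hu]
        have := hθA (s+u) (by linarith [hu.1]) (by linarith [hu.2])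
        rwa [sub_self, zero_sub, abs_neg]
      have hst' := ysh_step θ m (t - s) (F s) v ε hFs0 hv (fun u hu => by
          have hf := h.flow hs hu.1 (hcst u hu)
          have hp := h.pos (by linarith [hu.1] : 0 ≤ s + u)
          have hq := hFK (s+u) (by linarith [hu.1]) (by linarith [hu.2])
          rw [hf] at hp hq
          have h1 := hu.1
          have h2 := hu.2
          refine hη (m+1) hmr (t - s - u, F s * Real.exp (-θ * u)) (t - s, F s) ⟨⟨by simp only; linarith, by simp only; linarith⟩, hp.le, by
            simp only; linarith⟩ ⟨⟨by simp only; linarith, by simp only; linarith⟩, hFs0, by simp only; linarith⟩ ?_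
          rw [Prod.dist_eq, max_lt_iff, Real.dist_eq, Real.dist_eq]
          refine ⟨?_, hcl u hu⟩
          rw [abs_lt]; constructor <;> simp only <;> linarith) (fun u hu => by
          have hf := h.flow hs hu.1 (hcst u hu)
          have hp := h.pos (by linarith [hu.1] : 0 ≤ s + u)
          have hq := hFK (s+u) (by linarith [hu.1]) (by linarith [hu.2])
          rw [hf] at hp hq
          have h1 := hu.1
          have h2 := hu.2
          refine hη m hmr' (t - s - u, F s * Real.exp (-θ * u) + 1) (t - s, F s + 1) ⟨⟨by simp only; linarith, by simp only; linarith⟩, by simp only; linarith, by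
            simp only; linarith⟩ ⟨⟨by simp only; linarith, by simp only; linarith⟩, by simp only; linarith, by simp only; linarith⟩ ?_
          rw [Prod.dist_eq, max_lt_iff, Real.dist_eq, Real.dist_eq]
          refine ⟨?_, by simpa using hcl u hu⟩
          rw [abs_lt]; constructor <;> simp only <;> linarith)
      simp only [G, H, hy, e1, ← hm]
      rw [h.int_flow hs hv hy, h.flow hs hv hy, ← sub_sub t s v]
      convert hst' using 2 <;> ring

def pt (t : ℝ) (N i : ℕ) : ℝ := t * i / (N + 1 : ℝ)

theorem pt_mono {t : ℝ} (ht : 0 ≤ t) (N : ℕ) {i j : ℕ} (hij : i ≤ j) : pt t N i ≤ pt t N j := by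
  unfold pt
  have : (i : ℝ) ≤ j := by exact_mod_cast hij
  gcongr

theorem pt_zero (t : ℝ) (N : ℕ) : pt t N 0 = 0 := by simp [pt]
theorem pt_last (t : ℝ) (N : ℕ) : pt t N (N+1) = t := by
  unfold pt; push_cast; field_simp
theorem pt_nonneg {t : ℝ} (ht : 0 ≤ t) (N i : ℕ) : 0 ≤ pt t N i := by unfold pt; positivity

theorem sum_step (h : YPath θ y F) (n : ℕ) {t : ℝ} (ht : 0 ≤ t) :
    Tendsto (fun N : ℕ => ∑ i ∈ Finset.range (N+1), H θ y F n t (pt t N i) * (M y F (pt t N (i+1)) - M y F (pt t N i)))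
      atTop (𝓝 (G θ y F n t t - G θ y F n t 0)) := by
  rw [Metric.tendsto_atTop]
  intro ε' hε'
  set C := (y t : ℝ) - y 0 + ∫ u in (0:ℝ)..t, F u with hC
  have hC0 : 0 ≤ C := by
    have : (y 0 : ℝ) ≤ y t := h.monoR Set.self_mem_Ici ht ht
    have : 0 ≤ ∫ u in (0:ℝ)..t, F u := intervalIntegral.integral_nonneg ht fun x hx => (h.pos hx.1).le
    linarith
  obtain ⟨δ, hδ, hst⟩ := h.step n ht (ε := ε' / (4 * (C + 1))) (by positivity)
  obtain ⟨N0, hN0⟩ := exists_nat_gt (t / δ)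
  refine ⟨N0, fun N hN => ?_⟩
  have hmesh : t / (N + 1 : ℝ) < δ := by
    rw [div_lt_iff₀ hδ] at hN0
    rw [div_lt_iff₀ (by positivity)]
    have : (N0 : ℝ) ≤ N := by exact_mod_cast hN
    nlinarith
  have hG : G θ y F n t t - G θ y F n t 0 = ∑ i ∈ Finset.range (N+1), (G θ y F n t (pt t N (i+1)) - G θ y F n t (pt t N i)) := by
    rw [Finset.sum_range_sub (fun i => G θ y F n t (pt t N i)), pt_last, pt_zero]
  have hCs : C = ∑ i ∈ Finset.range (N+1), (((y (pt t N (i+1)) : ℝ) - y (pt t N i)) + ∫ u in (pt t N i)..(pt t N (i+1)), F u) := by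
    rw [Finset.sum_add_distrib, Finset.sum_range_sub (fun i => (y (pt t N i) : ℝ)),
      intervalIntegral.sum_integral_adjacent_intervals (fun k _ => h.int_F (pt_nonneg ht _ _) (pt_nonneg ht _ _)), pt_last, pt_zero]
  rw [dist_comm, Real.dist_eq, hG, ← Finset.sum_sub_distrib]
  refine (Finset.abs_sum_le_sum_abs _ _).trans_lt ?_
  have : ∑ i ∈ Finset.range (N+1), |G θ y F n t (pt t N (i+1)) - G θ y F n t (pt t N i) - H θ y F n t (pt t N i) * (M y F (pt t N (i+1)) - M y F (pt t N i))|
      ≤ 2 * (ε' / (4 * (C + 1))) * C := by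
    have e : 2 * (ε' / (4 * (C + 1))) * C = 2 * (ε' / (4 * (C + 1))) * ∑ i ∈ Finset.range (N+1), (((y (pt t N (i+1)) : ℝ) - y (pt t N i)) + ∫ u in (pt t N i)..(pt t N (i+1)), F u) := by
      rw [← hCs]
    rw [e, Finset.mul_sum]
    refine Finset.sum_le_sum fun i hi => ?_
    have hi' : i + 1 ≤ N + 1 := by rw [Finset.mem_range] at hi; omega
    refine hst _ _ (pt_nonneg ht _ _) (pt_mono ht _ (Nat.le_succ i)) ?_ ?_
    · rw [← pt_last t N]
      convert pt_mono ht N hi' using 1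
      rw [pt_last]
    · have : pt t N (i+1) - pt t N i = t / (N+1) := by unfold pt; push_cast; ring
      rw [this]; exact hmesh
  refine this.trans_lt ?_
  have e : 2 * (ε' / (4 * (C + 1))) * C = ε' / 2 * (C / (C + 1)) := by field_simp; ring
  rw [e]
  have : C / (C + 1) ≤ 1 := by rw [div_le_one (by positivity)]; linarith
  nlinarith

end YPath
end
namespace YuleSimonSetup
open Filter Topology YPath
variable {θ ρ : ℝ}

theorem path (S : YuleSimonSetup θ ρ) (ω : S.Ω) : YPath θ (fun t => S.Y t ω) (fun t => S.F t ω) where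
  y0 := S.Y0 ω
  mono := S.mono ω
  rc := S.rightCont ω
  uj := S.unitJumps ω
  F_def := S.F_def ω
  meas := S.measF.comp (measurable_id.prodMk measurable_const)

theorem measYt (S : YuleSimonSetup θ ρ) (t : ℝ) : Measurable (S.Y t) :=
  S.measY.comp (measurable_const.prodMk measurable_id)

theorem measFt (S : YuleSimonSetup θ ρ) (t : ℝ) : Measurable (S.F t) :=
  S.measF.comp (measurable_const.prodMk measurable_id)

theorem meas_ysh (θ : ℝ) (r : ℝ) : Measurable fun p : ℕ × ℝ => ysh θ p.1 r p.2 :=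
  measurable_from_prod_countable_right fun m =>
    ((ysh_continuous θ m).comp (by fun_prop : Continuous fun f : ℝ => (r, f))).measurable

/-- the functional defining H -/
theorem meas_Phi (θ : ℝ) (n : ℕ) (r : ℝ) : Measurable fun p : ℝ × ℝ =>
    ysh θ (n - ⌊p.1⌋₊) r (p.2 + 1) - ysh θ (n + 1 - ⌊p.1⌋₊) r p.2 := by
  have hfl : Measurable fun p : ℝ × ℝ => ⌊p.1⌋₊ := Nat.measurable_floor.comp measurable_fst
  refine Measurable.sub ?_ ?_
  · refine (meas_ysh θ r).comp (f := fun p : ℝ × ℝ => (n - ⌊p.1⌋₊, p.2 + 1)) ?_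
    exact ((measurable_of_countable fun k : ℕ => n - k).comp hfl).prodMk (by fun_prop)
  · refine (meas_ysh θ r).comp (f := fun p : ℝ × ℝ => (n + 1 - ⌊p.1⌋₊, p.2)) ?_
    exact ((measurable_of_countable fun k : ℕ => n + 1 - k).comp hfl).prodMk (by fun_prop)

theorem aesm_H (S : YuleSimonSetup θ ρ) (n : ℕ) (t : ℝ) {s : ℝ} (hs : 0 ≤ s) :
    AEStronglyMeasurable[S.ℱ s] (fun ω => YPath.H θ (fun t => S.Y t ω) (fun t => S.F t ω) n t s) S.P := by
  set c := S.P[fun ω => (S.Y s ω : ℝ) - ∫ u in (0:ℝ)..s, S.F u ω | S.ℱ s] with hc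
  have hcm : Measurable[S.ℱ s] c := stronglyMeasurable_condExp.measurable
  have hY : Measurable[S.ℱ s] fun ω => (S.Y s ω : ℝ) := S.adapted s
  have hf : Measurable[S.ℱ s] fun ω => (S.Y s ω : ℝ) - θ * ((S.Y s ω : ℝ) - c ω) :=
    hY.sub ((hY.sub hcm).const_mul θ)
  have hΦ : Measurable[S.ℱ s] fun ω => (fun p : ℝ × ℝ =>
      ysh θ (n - ⌊p.1⌋₊) (t - s) (p.2 + 1) - ysh θ (n + 1 - ⌊p.1⌋₊) (t - s) p.2)
      ((S.Y s ω : ℝ), (S.Y s ω : ℝ) - θ * ((S.Y s ω : ℝ) - c ω)) :=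
    (meas_Phi θ n (t - s)).comp (hY.prodMk hf)
  refine ⟨_, hΦ.stronglyMeasurable, ?_⟩
  filter_upwards [S.martingale s s hs le_rfl] with ω hω
  have e : (S.Y s ω : ℝ) - θ * ((S.Y s ω : ℝ) - c ω) = S.F s ω := by
    rw [S.F_def ω s hs, hc, hω]; ring
  simp only [e, Nat.floor_natCast, YPath.H]

theorem abs_H (S : YuleSimonSetup θ ρ) (n : ℕ) {t s : ℝ} (hs : 0 ≤ s) (hst : s ≤ t) (ω : S.Ω) :
    |YPath.H θ (fun t => S.Y t ω) (fun t => S.F t ω) n t s| ≤ 1 := by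
  have hp := ((S.path ω).pos hs).le
  have b1 := ysh_mem θ (n - S.Y s ω) (t - s) (S.F s ω + 1) (by linarith) (by linarith)
  have b2 := ysh_mem θ (n + 1 - S.Y s ω) (t - s) (S.F s ω) (by linarith) hp
  unfold YPath.H
  rw [abs_le]; constructor <;> linarith [b1.1, b1.2, b2.1, b2.2]

theorem int_M (S : YuleSimonSetup θ ρ) (s : ℝ) :
    Integrable (fun ω => YPath.M (fun t => S.Y t ω) (fun t => S.F t ω) s) S.P :=
  (S.integrableY s).sub (S.integrableF s)

theorem int_HM (S : YuleSimonSetup θ ρ) (n : ℕ) {t s : ℝ} (hs : 0 ≤ s) (hst : s ≤ t) (s' : ℝ) :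
    Integrable (fun ω => YPath.H θ (fun t => S.Y t ω) (fun t => S.F t ω) n t s *
      YPath.M (fun t => S.Y t ω) (fun t => S.F t ω) s') S.P :=
  (S.int_M s').bdd_mul (c := 1) ((S.aesm_H n t hs).mono (S.ℱ.le s))
    (Eventually.of_forall fun ω => S.abs_H n hs hst ω)

theorem integral_HM (S : YuleSimonSetup θ ρ) (n : ℕ) {t s s' : ℝ} (hs : 0 ≤ s) (hss : s ≤ s') (hst : s ≤ t) :
    ∫ ω, YPath.H θ (fun t => S.Y t ω) (fun t => S.F t ω) n t s *
      (YPath.M (fun t => S.Y t ω) (fun t => S.F t ω) s' -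
        YPath.M (fun t => S.Y t ω) (fun t => S.F t ω) s) ∂S.P = 0 := by
  simp only [mul_sub]
  rw [integral_sub (S.int_HM n hs hst s') (S.int_HM n hs hst s), sub_eq_zero]
  rw [← integral_condExp (S.ℱ.le s)]
  refine integral_congr_ae ?_
  have := condExp_mul_of_aestronglyMeasurable_left (S.aesm_H n t hs) (S.int_HM n hs hst s') (S.int_M s')
  refine this.trans ?_
  filter_upwards [S.martingale s s' hs hss] with ω hω
  simp only [Pi.mul_apply]
  congr 1

theorem prob_eq (S : YuleSimonSetup θ ρ) (n : ℕ) {t : ℝ} (ht : 0 ≤ t) :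
    S.P {ω | n < S.Y t ω} = ENNReal.ofReal (ysh θ n t 1) := by
  have hle : ∀ N i, i < N + 1 → pt t N i ≤ t := fun N i hi => by
    have := pt_mono ht N hi.le
    rwa [pt_last] at this
  have hG0 : ∀ ω, YPath.G θ (fun t => S.Y t ω) (fun t => S.F t ω) n t 0 = ysh θ n t 1 := fun ω => by
    have := S.F_def ω 0 le_rfl
    simp [S.Y0] at this
    simp [YPath.G, S.Y0, this]
  have hGt : ∀ ω, YPath.G θ (fun t => S.Y t ω) (fun t => S.F t ω) n t t =
      Set.indicator {ω | n < S.Y t ω} (fun _ => (1:ℝ)) ω := fun ω => by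
    by_cases h : n < S.Y t ω
    · rw [Set.indicator_of_mem (by exact h)]
      have : n + 1 - S.Y t ω = 0 := by omega
      simp only [YPath.G, this, ysh]
    · rw [Set.indicator_of_notMem (by exact h)]
      have : n + 1 - S.Y t ω = (n - S.Y t ω) + 1 := by omega
      simp only [YPath.G, this, sub_self, ysh_succ_zero]
  have hms : MeasurableSet {ω | n < S.Y t ω} := S.measYt t (measurableSet_Ioi (a := n))
  have hint : ∀ N i, i ∈ Finset.range (N+1) → Integrable (fun ω =>
      YPath.H θ (fun t => S.Y t ω) (fun t => S.F t ω) n t (pt t N i) *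
      (YPath.M (fun t => S.Y t ω) (fun t => S.F t ω) (pt t N (i+1)) -
        YPath.M (fun t => S.Y t ω) (fun t => S.F t ω) (pt t N i))) S.P := by
    intro N i hi
    simp only [mul_sub]
    have := hle N i (Finset.mem_range.1 hi)
    exact (S.int_HM n (pt_nonneg ht _ _) this _).sub (S.int_HM n (pt_nonneg ht _ _) this _)
  have hdc := tendsto_integral_of_dominated_convergence (μ := S.P)
    (F := fun (N : ℕ) ω => ∑ i ∈ Finset.range (N+1),
      YPath.H θ (fun t => S.Y t ω) (fun t => S.F t ω) n t (pt t N i) *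
      (YPath.M (fun t => S.Y t ω) (fun t => S.F t ω) (pt t N (i+1)) -
        YPath.M (fun t => S.Y t ω) (fun t => S.F t ω) (pt t N i)))
    (f := fun ω => YPath.G θ (fun t => S.Y t ω) (fun t => S.F t ω) n t t -
      YPath.G θ (fun t => S.Y t ω) (fun t => S.F t ω) n t 0)
    (fun ω => (S.Y t ω : ℝ) + ∫ u in (0:ℝ)..t, S.F u ω)
    (fun N => (integrable_finsetSum _ (hint N)).aestronglyMeasurable)
    ((S.integrableY t).add (S.integrableF t))
    (fun N => Eventually.of_forall fun ω => ?_)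
    (Eventually.of_forall fun ω => (S.path ω).sum_step n ht)
  · have h0 : ∀ N : ℕ, ∫ ω, ∑ i ∈ Finset.range (N+1),
      YPath.H θ (fun t => S.Y t ω) (fun t => S.F t ω) n t (pt t N i) *
      (YPath.M (fun t => S.Y t ω) (fun t => S.F t ω) (pt t N (i+1)) -
        YPath.M (fun t => S.Y t ω) (fun t => S.F t ω) (pt t N i)) ∂S.P = 0 := by
      intro N
      rw [integral_finsetSum _ (hint N)]
      refine Finset.sum_eq_zero fun i hi => ?_
      exact S.integral_HM n (pt_nonneg ht _ _) (pt_mono ht _ (Nat.le_succ i)) (hle N i (Finset.mem_range.1 hi))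
    simp only [h0, hG0, hGt] at hdc
    have e := tendsto_nhds_unique hdc tendsto_const_nhds
    rw [integral_sub ((integrable_const _).indicator hms) (integrable_const _), integral_indicator hms] at e
    simp only [integral_const, smul_eq_mul, mul_one, probReal_univ, one_mul, measureReal_restrict_apply_univ] at e
    rw [sub_eq_zero] at e
    rw [← e, ofReal_measureReal]
  · set y := fun t => S.Y t ω
    set F := fun t => S.F t ω
    have h : YPath θ y F := S.path ω
    have hC : (y t : ℝ) - y 0 + (∫ u in (0:ℝ)..t, F u) = ∑ i ∈ Finset.range (N+1), (((y (pt t N (i+1)) : ℝ) - y (pt t N i)) + ∫ u in (pt t N i)..(pt t N (i+1)), F u) := by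
      rw [Finset.sum_add_distrib, Finset.sum_range_sub (fun i => (y (pt t N i) : ℝ)),
        intervalIntegral.sum_integral_adjacent_intervals (fun k _ => h.int_F (pt_nonneg ht _ _) (pt_nonneg ht _ _)), pt_last, pt_zero]
    have hle' : (y t : ℝ) - y 0 + (∫ u in (0:ℝ)..t, F u) ≤ (y t : ℝ) + ∫ u in (0:ℝ)..t, F u := by
      have : (0:ℝ) ≤ y 0 := by positivity
      linarith
    refine le_trans ?_ hle'
    rw [hC, Real.norm_eq_abs]
    refine (Finset.abs_sum_le_sum_abs _ _).trans (Finset.sum_le_sum fun i hi => ?_)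
    have hs := pt_nonneg ht N i
    have hs' := pt_nonneg ht N (i+1)
    have hss := pt_mono ht N (Nat.le_succ i)
    have hH := S.abs_H n hs (hle N i (Finset.mem_range.1 hi)) ω
    rw [abs_mul]
    have hM : M y F (pt t N (i+1)) - M y F (pt t N i) =
        ((y (pt t N (i+1)) : ℝ) - y (pt t N i)) - ∫ u in (pt t N i)..(pt t N (i+1)), F u := by
      unfold M
      rw [← intervalIntegral.integral_add_adjacent_intervals (h.int_F0 hs) (h.int_F hs hs')]; ring
    have h1 : (y (pt t N i) : ℝ) ≤ y (pt t N (i+1)) := h.monoR hs hs' hss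
    have h2 : 0 ≤ ∫ u in (pt t N i)..(pt t N (i+1)), F u :=
      intervalIntegral.integral_nonneg hss fun x hx => (h.pos (hs.trans hx.1)).le
    refine (mul_le_of_le_one_left (abs_nonneg _) hH).trans ?_
    rw [hM, abs_le]
    constructor <;> linarith

theorem T_nonneg (S : YuleSimonSetup θ ρ) : ∀ᵐ ω ∂S.P, 0 ≤ S.T ω := by
  have h := S.lawT 0 le_rfl
  simp at h
  rw [ae_iff]
  refine measure_mono_null (fun ω hω => ?_) h
  simp only [Set.mem_setOf_eq, not_le] at hω ⊢
  exact hω.le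

theorem gt_iff (S : YuleSimonSetup θ ρ) (n : ℕ) {t : ℝ} (ht : 0 ≤ t) (ω : S.Ω) :
    n < S.Y t ω ↔ ∀ q : ℚ, t < q → n < S.Y q ω := by
  constructor
  · intro h q hq
    exact h.trans_le (S.mono ω ht (ht.trans hq.le : (0:ℝ) ≤ q) hq.le)
  · intro h
    obtain ⟨ε, hε, hc⟩ := S.rightCont ω t ht
    obtain ⟨q, hq1, hq2⟩ := exists_rat_btwn (by linarith : t < t + ε)
    rw [← hc q ⟨hq1.le, hq2⟩]
    exact h q hq1

theorem tail_eq (S : YuleSimonSetup θ ρ) (n : ℕ) :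
    S.tail n = ∫⁻ t, ENNReal.ofReal (ysh θ n t 1) ∂(S.P.map S.T) := by
  let E : Set (ℝ × (ℝ → ℕ)) := {p | ∀ q : ℚ, p.1 < q → n < p.2 q}
  have hE : MeasurableSet E := by
    have : E = ⋂ q : ℚ, ({p | (q:ℝ) ≤ p.1} ∪ {p | n < p.2 q}) := by
      ext p
      simp only [E, Set.mem_setOf_eq, Set.mem_iInter, Set.mem_union]
      exact forall_congr' fun q => by rw [← not_lt]; tauto
    rw [this]
    refine MeasurableSet.iInter fun q => MeasurableSet.union ?_ ?_
    · exact measurableSet_le measurable_const measurable_fst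
    · exact measurableSet_lt measurable_const ((measurable_pi_apply (q:ℝ)).comp measurable_snd)
  have hYm : Measurable fun ω => fun t : ℝ => S.Y t ω := measurable_pi_iff.2 fun t => S.measYt t
  have h1 : S.tail n = S.P ((fun ω => (S.T ω, fun t : ℝ => S.Y t ω)) ⁻¹' E) := by
    refine measure_congr ?_
    filter_upwards [S.T_nonneg] with ω hω
    exact propext (S.gt_iff n hω ω)
  rw [h1, ← Measure.map_apply (S.measT.prodMk hYm) hE,
    (indepFun_iff_map_prod_eq_prod_map_map S.measT.aemeasurable hYm.aemeasurable).1 S.indepT,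
    Measure.prod_apply hE]
  refine lintegral_congr_ae ?_
  have hT : ∀ᵐ t ∂(S.P.map S.T), 0 ≤ t :=
    (ae_map_iff S.measT.aemeasurable measurableSet_Ici).2 S.T_nonneg
  filter_upwards [hT] with t ht
  rw [← S.prob_eq n ht, Measure.map_apply hYm (measurable_prodMk_left hE)]
  congr 1
  ext ω
  exact (S.gt_iff n ht ω).symm

theorem map_T {θ' ρ' : ℝ} (hρ : 0 < ρ) (hρ' : 0 < ρ') (S : YuleSimonSetup θ ρ) (S' : YuleSimonSetup θ' ρ') :
    S'.P.map S'.T = (S.P.map S.T).map (fun t => ρ / ρ' * t) := by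
  have := Measure.isProbabilityMeasure_map (μ := S'.P) S'.measT.aemeasurable
  refine Measure.ext_of_Iic _ _ fun a => ?_
  have hm : Measurable fun t : ℝ => ρ / ρ' * t := by fun_prop
  have hk : 0 < ρ / ρ' := by positivity
  rw [Measure.map_map hm S.measT, Measure.map_apply S'.measT measurableSet_Iic,
    Measure.map_apply (hm.comp S.measT) measurableSet_Iic]
  have e1 : S'.T ⁻¹' Set.Iic a = {ω | S'.T ω ≤ a} := rfl
  have e2 : ((fun t => ρ / ρ' * t) ∘ S.T) ⁻¹' Set.Iic a = {ω | S.T ω ≤ ρ' / ρ * a} := by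
    ext ω
    simp only [Set.mem_preimage, Function.comp, Set.mem_Iic, Set.mem_setOf_eq]
    rw [← le_div_iff₀' hk]
    have : a / (ρ / ρ') = ρ' / ρ * a := by field_simp
    rw [this]
  rw [e1, e2]
  rcases le_or_gt 0 a with ha | ha
  · rw [S'.lawT a ha, S.lawT _ (by positivity)]
    congr 3; field_simp
  · have z1 : S'.P {ω | S'.T ω ≤ a} = 0 := by
      refine measure_mono_null (fun ω hω => ?_) (ae_iff.1 S'.T_nonneg)
      simp only [Set.mem_setOf_eq, not_le] at hω ⊢; linarith
    have z2 : S.P {ω | S.T ω ≤ ρ' / ρ * a} = 0 := by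
      refine measure_mono_null (fun ω hω => ?_) (ae_iff.1 S.T_nonneg)
      simp only [Set.mem_setOf_eq, not_le] at hω ⊢
      have : ρ' / ρ * a < 0 := mul_neg_of_pos_of_neg (by positivity) ha
      linarith
    rw [z1, z2]

end YuleSimonSetup

/-- The two-parameter Yule–Simon variable is stochastically decreasing in both
parameters: if `θ' ≥ θ` and `ρ' ≥ ρ > 0` then
`P(X_{θ',ρ'} > n) ≤ P(X_{θ,ρ} > n)` for all `n ≥ 1`. -/
theorem yule_simon_stochastic_monotonicity
    (θ θ' ρ ρ' : ℝ) (hθ : θ ≤ θ') (hρ : 0 < ρ) (hρ' : ρ ≤ ρ')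
    (S : YuleSimonSetup θ ρ) (S' : YuleSimonSetup θ' ρ') (n : ℕ) (hn : 1 ≤ n) :
    S'.tail n ≤ S.tail n := by
  have hρ'0 : 0 < ρ' := hρ.trans_le hρ'
  have hc : Measurable fun t => ENNReal.ofReal (ysh θ' n t 1) := by
    have := ((ysh_continuous θ' n).comp (by fun_prop : Continuous fun t : ℝ => (t, (1:ℝ)))).measurable
    exact this.ennreal_ofReal
  rw [S.tail_eq, S'.tail_eq, YuleSimonSetup.map_T hρ hρ'0 S S', lintegral_map hc (by fun_prop)]
  have hT : ∀ᵐ t ∂(S.P.map S.T), 0 ≤ t :=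
    (ae_map_iff S.measT.aemeasurable measurableSet_Ici).2 S.T_nonneg
  refine lintegral_mono_ae ?_
  filter_upwards [hT] with t ht
  refine ENNReal.ofReal_le_ofReal (ysh_mono hθ n _ _ _ _ (by positivity) ?_ one_pos le_rfl)
  exact mul_le_of_le_one_left ht ((div_le_one hρ'0).2 hρ')
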